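/- For every ε > 0 there exists a constant C = C(ε) > 0 with the following property. Let Q ≥ 1 be a real number, let 𝒬 be a finite nonempty set of positive integers contained in [1, Q], let L = Σ_{q∈𝒬} φ(q), and let δ be a real number with Q^{−2} ≤ δ ≤ Q^{−1}. Then ∫₀¹ |1 − Ĩ_{𝒬,δ}(x)|² dx ≤ C · Q^{2+ε} / (δ L²). -/

import Mathlib

open MeasureTheory

/-- Jutila's approximant `Ĩ_{𝒬,δ}` to the indicator of `[0,1]`:
`Ĩ_{𝒬,δ}(x) = (1/(2δL)) ∑_{q ∈ 𝒬} ∑_{a ∈ ℤ, gcd(a,q)=1} 𝟙_{[a/q-δ, a/q+δ]}(x)`,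
where `L = ∑_{q ∈ 𝒬} φ(q)`. -/
noncomputable def jutilaApprox (𝒬 : Finset ℕ) (δ : ℝ) (x : ℝ) : ℝ :=
  (2 * δ * ∑ q ∈ 𝒬, (Nat.totient q : ℝ))⁻¹ *
    ∑ q ∈ 𝒬, ∑' a : ℤ,
      if Int.gcd a q = 1 then
        Set.indicator (Set.Icc ((a : ℝ) / q - δ) ((a : ℝ) / q + δ)) (fun _ => (1 : ℝ)) x
      else 0

open Finset Function ArithmeticFunction ArithmeticFunction.Moebius

/-- The deviation of the number of integers `b` with `|x - b / d| ≤ δ` from its mean `2 * d * δ`. -/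
noncomputable def countDev (δ : ℝ) (d : ℕ) (x : ℝ) : ℝ :=
  1 - Int.fract (d * x + d * δ) - Int.fract (-(d * x) + d * δ)

lemma countDev_eq_floor_sub_ceil (δ : ℝ) (d : ℕ) (x : ℝ) :
    countDev δ d x = (⌊d * (x + δ)⌋ : ℝ) + 1 - ⌈d * (x - δ)⌉ - 2 * d * δ := by
  have h : ⌈d * (x - δ)⌉ = -⌊-((d : ℝ) * x) + d * δ⌋ := by
    rw [← Int.ceil_neg]; congr 1; ring
  rw [h, countDev, Int.fract, Int.fract, mul_add]
  push_cast
  ring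

lemma abs_one_sub_fract_sub_fract_le (u v : ℝ) : |1 - Int.fract u - Int.fract v| ≤ 1 := by
  have := Int.fract_nonneg u
  have := Int.fract_nonneg v
  have := Int.fract_lt_one u
  have := Int.fract_lt_one v
  rw [abs_le]
  constructor <;> linarith

lemma abs_countDev_le (δ : ℝ) (d : ℕ) (x : ℝ) : |countDev δ d x| ≤ 1 :=
  abs_one_sub_fract_sub_fract_le _ _

lemma measurable_countDev (δ : ℝ) (d : ℕ) : Measurable (countDev δ d) := by
  unfold countDev
  refine Measurable.sub (measurable_const.sub (Measurable.fract ?_)) (Measurable.fract ?_) <;>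
    fun_prop

lemma neg_two_mul_le_countDev {δ : ℝ} (hδ : 0 ≤ δ) (d : ℕ) (x : ℝ) :
    -(2 * d * δ) ≤ countDev δ d x := by
  have h1 : ⌈d * (x - δ)⌉ < ⌊d * (x + δ)⌋ + 2 := by
    have h2 := Int.ceil_lt_add_one ((d : ℝ) * (x - δ))
    have h3 := Int.lt_floor_add_one ((d : ℝ) * (x + δ))
    have h4 : (d : ℝ) * (x - δ) ≤ d * (x + δ) := by gcongr; linarith
    exact_mod_cast (by linarith : (⌈d * (x - δ)⌉ : ℝ) < ⌊d * (x + δ)⌋ + 2)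
  have h5 : (⌈d * (x - δ)⌉ : ℝ) ≤ ⌊d * (x + δ)⌋ + 1 := by
    exact_mod_cast (by omega : ⌈d * (x - δ)⌉ ≤ ⌊d * (x + δ)⌋ + 1)
  rw [countDev_eq_floor_sub_ceil]
  linarith

lemma countDev_add_of_mul_eq_int (δ : ℝ) (d : ℕ) (x t : ℝ) (n : ℤ) (h : d * t = n) :
    countDev δ d (x + t) = countDev δ d x := by
  have h1 : (d : ℝ) * (x + t) + d * δ = d * x + d * δ + n := by rw [← h]; ring
  have h2 : -((d : ℝ) * (x + t)) + d * δ = -(d * x) + d * δ - n := by rw [← h]; ring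
  rw [countDev, h1, h2, Int.fract_add_intCast, Int.fract_sub_intCast, countDev]

lemma countDev_periodic (δ : ℝ) (d : ℕ) : Periodic (countDev δ d) 1 := fun x ↦
  countDev_add_of_mul_eq_int δ d x 1 d (by simp)

lemma intervalIntegrable_of_abs_le {f : ℝ → ℝ} (hf : Measurable f) {M : ℝ} (h : ∀ x, |f x| ≤ M)
    (a b : ℝ) : IntervalIntegrable f volume a b :=
  intervalIntegrable_const.mono_fun (g := f) (f := fun _ ↦ M) hf.aestronglyMeasurable
    (.of_forall fun x ↦ (h x).trans (le_abs_self M))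

lemma abs_fract_le_one (x : ℝ) : |Int.fract x| ≤ 1 := by
  rw [abs_of_nonneg (Int.fract_nonneg x)]
  exact (Int.fract_lt_one x).le

lemma intervalIntegrable_fract (a b : ℝ) :
    IntervalIntegrable (Int.fract : ℝ → ℝ) volume a b :=
  intervalIntegrable_of_abs_le measurable_fract abs_fract_le_one a b

lemma integral_fract_zero_one : ∫ x in (0 : ℝ)..1, Int.fract x = 1 / 2 := by
  have h : ∫ x in (0 : ℝ)..1, Int.fract x = ∫ x in (0 : ℝ)..1, x := by
    refine intervalIntegral.integral_congr_ae ?_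
    filter_upwards [(Set.countable_singleton (1 : ℝ)).ae_notMem volume] with x hx hx'
    rw [Set.uIoc_of_le zero_le_one] at hx'
    exact Int.fract_eq_self.2 ⟨hx'.1.le, lt_of_le_of_ne hx'.2 hx⟩
  rw [h, integral_id]
  norm_num

lemma integral_fract_intCast_mul_add {n : ℤ} (hn : n ≠ 0) (c : ℝ) :
    ∫ x in (0 : ℝ)..1, Int.fract (n * x + c) = 1 / 2 := by
  have hn' : (n : ℝ) ≠ 0 := Int.cast_ne_zero.2 hn
  rw [intervalIntegral.integral_comp_mul_add (fun x ↦ Int.fract x) hn' c]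
  have h := (Int.fract_periodic ℝ).intervalIntegral_add_zsmul_eq n c
    (fun a b ↦ intervalIntegrable_fract a b)
  rw [zsmul_eq_mul, zsmul_eq_mul, mul_one, (Int.fract_periodic ℝ).intervalIntegral_add_eq c 0,
    zero_add, integral_fract_zero_one] at h
  rw [mul_zero, mul_one, zero_add, add_comm (n : ℝ) c, h, smul_eq_mul]
  field_simp

lemma integral_countDev (δ : ℝ) {d : ℕ} (hd : 0 < d) :
    ∫ x in (0 : ℝ)..1, countDev δ d x = 0 := by
  have hd' : (d : ℤ) ≠ 0 := by exact_mod_cast hd.ne'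
  have h1 := integral_fract_intCast_mul_add hd' (d * δ)
  have h2 := integral_fract_intCast_mul_add (neg_ne_zero.2 hd') (d * δ)
  push_cast at h1 h2
  simp only [neg_mul] at h2
  have hi (g : ℝ → ℝ) (hg : Measurable g) :
      IntervalIntegrable (fun x ↦ Int.fract (g x)) volume 0 1 :=
    intervalIntegrable_of_abs_le hg.fract (fun x ↦ abs_fract_le_one _) 0 1
  unfold countDev
  rw [intervalIntegral.integral_sub, intervalIntegral.integral_sub, h1, h2]
  · norm_num
  · exact intervalIntegrable_const
  · exact hi _ (by fun_prop)
  · exact intervalIntegrable_const.sub (hi _ (by fun_prop))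
  · exact hi _ (by fun_prop)

lemma intervalIntegrable_countDev (δ : ℝ) (d : ℕ) (a b : ℝ) :
    IntervalIntegrable (countDev δ d) volume a b :=
  intervalIntegrable_of_abs_le (measurable_countDev δ d) (abs_countDev_le δ d) a b

lemma integral_abs_countDev_le {δ : ℝ} (hδ : 0 ≤ δ) {d : ℕ} (hd : 0 < d) :
    ∫ x in (0 : ℝ)..1, |countDev δ d x| ≤ 4 * d * δ := by
  have h : ∫ x in (0 : ℝ)..1, |countDev δ d x| ≤
      ∫ x in (0 : ℝ)..1, (countDev δ d x + 4 * d * δ) := by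
    refine intervalIntegral.integral_mono_on zero_le_one (intervalIntegrable_countDev δ d 0 1).abs
      ((intervalIntegrable_countDev δ d 0 1).add intervalIntegrable_const) fun x _ ↦ ?_
    have := neg_two_mul_le_countDev hδ d x
    have : 0 ≤ d * δ := by positivity
    rw [abs_le]
    constructor <;> linarith
  rwa [intervalIntegral.integral_add (intervalIntegrable_countDev δ d 0 1)
    intervalIntegrable_const, integral_countDev δ hd, intervalIntegral.integral_const, sub_zero,
    one_smul, zero_add] at h

/-- Hermite's identity for fractional parts. -/
lemma sum_fract_add_div {a : ℕ} (ha : 0 < a) (y : ℝ) :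
    ∑ j ∈ range a, Int.fract (y + j / a) = Int.fract (a * y) + (a - 1) / 2 := by
  have ha' : (0 : ℝ) < a := Nat.cast_pos.2 ha
  set f : ℝ → ℝ := fun y ↦ ∑ j ∈ range a, Int.fract (y + j / a) - Int.fract (a * y) with hf
  have hper : Periodic f (1 / a) := fun y ↦ by
    have h1 : ∑ j ∈ range a, Int.fract (y + 1 / a + j / a) =
        ∑ j ∈ range a, Int.fract (y + j / a) := by
      have h2 := sum_range_succ' (fun j : ℕ ↦ Int.fract (y + j / a)) a
      rw [sum_range_succ, div_self ha'.ne', Int.fract_add_one] at h2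
      simp only [Nat.cast_zero, zero_div, add_zero] at h2
      rw [add_right_cancel h2]
      refine sum_congr rfl fun j _ ↦ ?_
      congr 1
      push_cast
      ring
    have h3 : (a : ℝ) * (y + 1 / a) = a * y + 1 := by field_simp
    simp only [hf, h1, h3, Int.fract_add_one]
  obtain ⟨z, hz, hyz⟩ := hper.exists_mem_Ico₀ (by positivity) y
  have hz1 : a * z < 1 := by
    have := hz.2
    rwa [lt_div_iff₀ ha', mul_comm] at this
  have hfz : f z = (a - 1) / 2 := by
    have h1 : ∀ j ∈ range a, Int.fract (z + j / a) = z + j / a := fun j hj ↦ by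
      have hj' : (j : ℝ) + 1 ≤ a := by exact_mod_cast mem_range.1 hj
      refine Int.fract_eq_self.2 ⟨add_nonneg hz.1 (by positivity), ?_⟩
      calc z + j / a < 1 / a + j / a := by gcongr; exact hz.2
        _ = (j + 1) / a := by ring
        _ ≤ 1 := (div_le_one ha').2 hj'
    have h2 : ∑ j ∈ range a, (j : ℝ) = a * (a - 1) / 2 := by
      have := Finset.sum_range_id_mul_two a
      have h3 : ((∑ j ∈ range a, j : ℕ) : ℝ) * 2 = a * ((a - 1 : ℕ) : ℝ) := by exact_mod_cast this
      rw [Nat.cast_sub ha] at h3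
      push_cast at h3
      linarith
    simp only [hf]
    rw [sum_congr rfl h1, Int.fract_eq_self.2 ⟨mul_nonneg ha'.le hz.1, hz1⟩, sum_add_distrib,
      ← sum_div, h2, sum_const, card_range, nsmul_eq_mul]
    field_simp
    ring
  have : f y = (a - 1) / 2 := hyz.trans hfz
  simp only [hf] at this
  linarith

lemma sum_fract_sub_div {a : ℕ} (ha : 0 < a) (y : ℝ) :
    ∑ j ∈ range a, Int.fract (y - j / a) = Int.fract (a * y) + (a - 1) / 2 := by
  have ha' : (0 : ℝ) < a := Nat.cast_pos.2 ha
  rw [← sum_range_reflect]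
  have h : ∀ j ∈ range a, Int.fract (y - ((a - 1 - j : ℕ) : ℝ) / a) =
      Int.fract (y - (a - 1 : ℕ) / a + j / a) := fun j hj ↦ by
    rw [Nat.cast_sub (by have := mem_range.1 hj; omega)]
    congr 1
    ring
  rw [sum_congr rfl h, sum_fract_add_div ha]
  have h2 : (a : ℝ) * (y - (a - 1 : ℕ) / a) = a * y - (a - 1 : ℕ) := by field_simp
  rw [h2, Int.fract_sub_natCast]

/-- Averaging over a full period of the other frequency leaves at most one unit. -/
lemma abs_sum_countDev_add_le (δ : ℝ) {a e : ℕ} (ha : 0 < a) (t : ℝ)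
    (ht : ∀ j : ℕ, ∃ m : ℤ, e * (j * t) = j / a + m) (x : ℝ) :
    |∑ j ∈ range a, countDev δ e (x + j * t)| ≤ 1 := by
  have h : ∀ j ∈ range a, countDev δ e (x + j * t) =
      1 - Int.fract (e * x + e * δ + j / a) - Int.fract (-(e * x) + e * δ - j / a) := fun j _ ↦ by
    obtain ⟨m, hm⟩ := ht j
    have h1 : (e : ℝ) * (x + j * t) + e * δ = e * x + e * δ + j / a + m := by
      linear_combination hm
    have h2 : -((e : ℝ) * (x + j * t)) + e * δ = -(e * x) + e * δ - j / a - m := by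
      linear_combination -hm
    rw [countDev, h1, h2, Int.fract_add_intCast, Int.fract_sub_intCast]
  rw [sum_congr rfl h, sum_sub_distrib, sum_sub_distrib, sum_fract_add_div ha,
    sum_fract_sub_div ha, sum_const, card_range, nsmul_eq_mul, mul_one]
  convert abs_one_sub_fract_sub_fract_le (a * (e * x + e * δ)) (a * (-(e * x) + e * δ)) using 2
  ring

lemma abs_integral_countDev_mul_le {δ : ℝ} (hδ : 0 ≤ δ) {d e : ℕ} (hd : 0 < d) :
    |∫ x in (0 : ℝ)..1, countDev δ d x * countDev δ e x| ≤ 4 * δ * Nat.gcd d e := by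
  obtain ⟨a, ha⟩ := Nat.gcd_dvd_left d e
  set g := Nat.gcd d e with hg
  have hg0 : 0 < g := Nat.gcd_pos_of_pos_left e hd
  have ha0 : 0 < a := Nat.pos_of_mul_pos_left (ha ▸ hd)
  have hgR : (0 : ℝ) < g := Nat.cast_pos.2 hg0
  have haR : (0 : ℝ) < a := Nat.cast_pos.2 ha0
  have hdR : (d : ℝ) = g * a := by exact_mod_cast ha
  set u := Nat.gcdB d e
  set v := Nat.gcdA d e
  have hbez : (g : ℝ) = d * v + e * u := by exact_mod_cast Nat.gcd_eq_gcd_ab d e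
  set t : ℝ := u / d with ht
  have hdt : (d : ℝ) * t = u := by
    rw [ht]; field_simp
  have het (j : ℕ) : ∃ m : ℤ, (e : ℝ) * (j * t) = j / a + m := by
    refine ⟨-(v * j), ?_⟩
    have : (e : ℝ) * t = 1 / a - v := by
      rw [ht, hdR] at *
      field_simp
      linarith
    push_cast
    linear_combination (j : ℝ) * this
  have hshift (j : ℕ) : ∫ x in (0 : ℝ)..1, countDev δ d x * countDev δ e x =
      ∫ x in (0 : ℝ)..1, countDev δ d x * countDev δ e (x + j * t) := by
    have hp : Periodic (fun x ↦ countDev δ d x * countDev δ e x) 1 := fun x ↦ by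
      simp only [countDev_periodic δ d x, countDev_periodic δ e x]
    have h1 := hp.intervalIntegral_add_eq 0 (j * t)
    rw [zero_add] at h1
    have h2 := intervalIntegral.integral_comp_add_right (a := 0) (b := 1)
      (fun x ↦ countDev δ d x * countDev δ e x) (j * t)
    rw [zero_add, add_comm 1] at h2
    rw [h1, ← h2]
    refine intervalIntegral.integral_congr fun x _ ↦ ?_
    rw [countDev_add_of_mul_eq_int δ d x (j * t) (j * u) (by push_cast; rw [← hdt]; ring)]
  have hmeas (j : ℕ) : Measurable fun x ↦ countDev δ e (x + j * t) :=
    (measurable_countDev δ e).comp (measurable_id.add_const _)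
  have hsum : a * ∫ x in (0 : ℝ)..1, countDev δ d x * countDev δ e x =
      ∫ x in (0 : ℝ)..1, countDev δ d x * ∑ j ∈ range a, countDev δ e (x + j * t) := by
    simp only [mul_sum]
    rw [intervalIntegral.integral_finsetSum]
    · rw [← sum_congr rfl fun j _ ↦ hshift j, sum_const, card_range, nsmul_eq_mul]
    · intro j _
      refine intervalIntegrable_of_abs_le ((measurable_countDev δ d).mul (hmeas j)) (M := 1)
        (fun x ↦ ?_) 0 1
      rw [Pi.mul_apply, abs_mul]
      exact mul_le_one₀ (abs_countDev_le _ _ _) (abs_nonneg _) (abs_countDev_le _ _ _)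
  have hbound : |a * ∫ x in (0 : ℝ)..1, countDev δ d x * countDev δ e x| ≤ 4 * d * δ := by
    rw [hsum]
    refine le_trans ?_ (integral_abs_countDev_le hδ hd)
    rw [← Real.norm_eq_abs]
    refine intervalIntegral.norm_integral_le_of_norm_le zero_le_one (.of_forall fun x _ ↦ ?_)
      (intervalIntegrable_countDev δ d 0 1).abs
    rw [Real.norm_eq_abs, abs_mul]
    exact mul_le_of_le_one_right (abs_nonneg _) (abs_sum_countDev_add_le δ ha0 t het x)
  rw [abs_mul, abs_of_pos haR, hdR] at hbound
  refine le_of_mul_le_mul_left (hbound.trans_eq ?_) haR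
  ring

lemma card_filter_dvd_Icc_ceil_floor {k : ℕ} (hk : 0 < k) {u v : ℝ} (huv : u ≤ v) :
    (#{a ∈ Icc ⌈u⌉ ⌊v⌋ | (k : ℤ) ∣ a} : ℝ) = ⌊v / k⌋ + 1 - ⌈u / k⌉ := by
  have hk' : (0 : ℝ) < k := Nat.cast_pos.2 hk
  have hinj : Injective fun b : ℤ ↦ (k : ℤ) * b :=
    mul_right_injective₀ (by exact_mod_cast hk.ne')
  have himage : {a ∈ Icc ⌈u⌉ ⌊v⌋ | (k : ℤ) ∣ a} =
      (Icc ⌈u / k⌉ ⌊v / k⌋).image fun b : ℤ ↦ (k : ℤ) * b := by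
    have hmem (b : ℤ) : (⌈u⌉ ≤ k * b ∧ k * b ≤ ⌊v⌋) ↔ ⌈u / k⌉ ≤ b ∧ b ≤ ⌊v / k⌋ := by
      rw [Int.ceil_le, Int.ceil_le, Int.le_floor, Int.le_floor, div_le_iff₀ hk', le_div_iff₀ hk']
      push_cast
      rw [mul_comm (b : ℝ)]
    ext a
    simp only [mem_filter, mem_Icc, mem_image]
    constructor
    · rintro ⟨h, b, rfl⟩
      exact ⟨b, (hmem b).1 h, rfl⟩
    · rintro ⟨b, h, rfl⟩
      exact ⟨(hmem b).2 h, dvd_mul_right _ _⟩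
  have hle : ⌈u / k⌉ ≤ ⌊v / k⌋ + 1 := by
    have h1 := Int.ceil_lt_add_one (u / k)
    have h2 := Int.lt_floor_add_one (v / k)
    have h3 : u / k ≤ v / k := by gcongr
    have : ⌈u / k⌉ < ⌊v / k⌋ + 2 := by
      exact_mod_cast (by linarith : (⌈u / k⌉ : ℝ) < ⌊v / k⌋ + 2)
    omega
  rw [himage, card_image_of_injective _ hinj, Int.card_Icc]
  have : (((⌊v / k⌋ + 1 - ⌈u / k⌉).toNat : ℤ) : ℝ) = ((⌊v / k⌋ + 1 - ⌈u / k⌉ : ℤ) : ℝ) := by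
    rw [Int.toNat_of_nonneg (by omega)]
  push_cast at this
  exact_mod_cast this

lemma ite_gcd_eq_one_eq_sum_moebius {q : ℕ} (hq : 0 < q) (a : ℤ) :
    (if Int.gcd a q = 1 then (1 : ℝ) else 0) =
      ∑ k ∈ q.divisors, if (k : ℤ) ∣ a then (μ k : ℝ) else 0 := by
  have hg : Int.gcd a q ≠ 0 :=
    (Int.gcd_pos_iff.2 (Or.inr (by exact_mod_cast hq.ne'))).ne'
  have h1 : ∑ k ∈ (Int.gcd a q).divisors, μ k = if Int.gcd a q = 1 then 1 else 0 := by
    have := congrArg (fun f : ArithmeticFunction ℤ ↦ f (Int.gcd a q)) coe_zeta_mul_moebius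
    simpa only [coe_zeta_mul_apply, one_apply] using this
  have h2 : (Int.gcd a q).divisors = {k ∈ q.divisors | ((k : ℕ) : ℤ) ∣ a} := by
    ext k
    simp only [Nat.mem_divisors, mem_filter, ne_eq, hg, hq.ne', not_false_eq_true, and_true]
    rw [Int.gcd, Int.natAbs_natCast, Nat.dvd_gcd_iff, Int.natCast_dvd, and_comm]
  rw [← sum_filter, ← h2]
  exact_mod_cast h1.symm

lemma totient_eq_sum_moebius {q : ℕ} (hq : 0 < q) :
    (q.totient : ℝ) = ∑ x ∈ q.divisorsAntidiagonal, (μ x.1 : ℝ) * x.2 := by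
  refine ((sum_eq_iff_sum_mul_moebius_eq (f := fun n ↦ (n.totient : ℝ))
    (g := fun n ↦ (n : ℝ))).1 (fun n _ ↦ ?_) q hq).symm
  exact_mod_cast Nat.sum_totient n

/-- The local counting function of reduced fractions with denominator `q`, by Möbius inversion. -/
lemma tsum_reduced_fractions {δ : ℝ} (hδ : 0 ≤ δ) {q : ℕ} (hq : 0 < q) (x : ℝ) :
    (∑' a : ℤ, if Int.gcd a q = 1 then
        Set.indicator (Set.Icc ((a : ℝ) / q - δ) ((a : ℝ) / q + δ)) (fun _ => (1 : ℝ)) x else 0) =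
      2 * δ * q.totient + ∑ y ∈ q.divisorsAntidiagonal, (μ y.1 : ℝ) * countDev δ y.2 x := by
  have hq' : (0 : ℝ) < q := Nat.cast_pos.2 hq
  have hmem (a : ℤ) : x ∈ Set.Icc ((a : ℝ) / q - δ) ((a : ℝ) / q + δ) ↔
      a ∈ Icc ⌈q * (x - δ)⌉ ⌊q * (x + δ)⌋ := by
    rw [Set.mem_Icc, mem_Icc, Int.ceil_le, Int.le_floor, sub_le_iff_le_add, ← sub_le_iff_le_add (a := x),
      div_le_iff₀ hq', le_div_iff₀ hq', mul_comm (x + δ), mul_comm (x - δ), and_comm]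
  rw [tsum_eq_sum (s := Icc ⌈q * (x - δ)⌉ ⌊q * (x + δ)⌋)]
  · have h1 : ∀ a ∈ Icc ⌈q * (x - δ)⌉ ⌊q * (x + δ)⌋, (if Int.gcd a q = 1 then
        Set.indicator (Set.Icc ((a : ℝ) / q - δ) ((a : ℝ) / q + δ)) (fun _ => (1 : ℝ)) x else 0) =
        ∑ k ∈ q.divisors, if (k : ℤ) ∣ a then (μ k : ℝ) else 0 := fun a ha ↦ by
      rw [Set.indicator_of_mem ((hmem a).2 ha), ite_gcd_eq_one_eq_sum_moebius hq]
    rw [sum_congr rfl h1, sum_comm, totient_eq_sum_moebius hq, mul_sum, ← sum_add_distrib,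
      Nat.sum_divisorsAntidiagonal
        fun k d ↦ 2 * δ * ((μ k : ℝ) * (d : ℝ)) + (μ k : ℝ) * countDev δ d x]
    refine sum_congr rfl fun k hk ↦ ?_
    obtain ⟨d, rfl⟩ := Nat.dvd_of_mem_divisors hk
    have hk0 : 0 < k := Nat.pos_of_mul_pos_right hq
    have hk' : (k : ℝ) ≠ 0 := by exact_mod_cast hk0.ne'
    have hle : ((k * d : ℕ) : ℝ) * (x - δ) ≤ (k * d : ℕ) * (x + δ) := by gcongr; linarith
    rw [← sum_filter, sum_const, nsmul_eq_mul, card_filter_dvd_Icc_ceil_floor hk0 hle]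
    rw [Nat.mul_div_cancel_left d hk0]
    have hdiv (z : ℝ) : ((k * d : ℕ) : ℝ) * z / k = d * z := by push_cast; field_simp
    rw [hdiv, hdiv, countDev_eq_floor_sub_ceil]
    ring
  · intro a ha
    rw [Set.indicator_of_notMem (fun h ↦ ha ((hmem a).1 h)), ite_self]

lemma sum_inv_Icc_le (N : ℕ) : ∑ d ∈ Icc 1 N, ((d : ℝ))⁻¹ ≤ 1 + Real.log N := by
  have h := harmonic_le_one_add_log N
  rw [harmonic_eq_sum_Icc] at h
  push_cast at h
  exact h

lemma sum_inv_filter_dvd_le (N : ℕ) {h : ℕ} (hh : 0 < h) :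
    ∑ d ∈ Icc 1 N with h ∣ d, ((d : ℝ))⁻¹ ≤ (h : ℝ)⁻¹ * ∑ d ∈ Icc 1 N, ((d : ℝ))⁻¹ := by
  have hinj : Injective fun m : ℕ ↦ h * m := mul_right_injective₀ hh.ne'
  have hsub : {d ∈ Icc 1 N | h ∣ d} ⊆ (Icc 1 N).image fun m ↦ h * m := by
    intro d hd
    simp only [mem_filter, mem_Icc] at hd
    obtain ⟨⟨h1, h2⟩, m, rfl⟩ := hd
    refine mem_image.2 ⟨m, mem_Icc.2 ⟨Nat.pos_of_mul_pos_left h1, ?_⟩, rfl⟩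
    exact (Nat.le_mul_of_pos_left m hh).trans h2
  refine (sum_le_sum_of_subset_of_nonneg hsub fun _ _ _ ↦ by positivity).trans_eq ?_
  rw [sum_image hinj.injOn, mul_sum]
  refine sum_congr rfl fun m _ ↦ ?_
  push_cast
  rw [mul_inv]

lemma sum_gcd_div_mul_le (N : ℕ) :
    ∑ d ∈ Icc 1 N, ∑ e ∈ Icc 1 N, (d : ℝ)⁻¹ * (e : ℝ)⁻¹ * Nat.gcd d e ≤
      (∑ d ∈ Icc 1 N, ((d : ℝ))⁻¹) ^ 3 := by
  set H := ∑ d ∈ Icc 1 N, ((d : ℝ))⁻¹ with hH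
  have hH0 : 0 ≤ H := sum_nonneg fun _ _ ↦ by positivity
  have hgcd : ∀ d ∈ Icc 1 N, ∀ e ∈ Icc 1 N, (d : ℝ)⁻¹ * (e : ℝ)⁻¹ * Nat.gcd d e ≤
      ∑ h ∈ Icc 1 N, (h : ℝ) * ((if h ∣ d then (d : ℝ)⁻¹ else 0) *
        if h ∣ e then (e : ℝ)⁻¹ else 0) := fun d hd e _ ↦ by
    have hd1 := (mem_Icc.1 hd).1
    have hmem : Nat.gcd d e ∈ Icc 1 N := mem_Icc.2
      ⟨Nat.gcd_pos_of_pos_left e hd1, (Nat.gcd_le_left e hd1).trans (mem_Icc.1 hd).2⟩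
    refine le_trans (le_of_eq ?_) (single_le_sum (f := fun h : ℕ ↦ (h : ℝ) *
      ((if h ∣ d then (d : ℝ)⁻¹ else 0) * if h ∣ e then (e : ℝ)⁻¹ else 0))
      (fun h _ ↦ by positivity) hmem)
    simp only [Nat.gcd_dvd_left, Nat.gcd_dvd_right, if_true]
    ring
  calc ∑ d ∈ Icc 1 N, ∑ e ∈ Icc 1 N, (d : ℝ)⁻¹ * (e : ℝ)⁻¹ * Nat.gcd d e
      ≤ ∑ d ∈ Icc 1 N, ∑ e ∈ Icc 1 N, ∑ h ∈ Icc 1 N, (h : ℝ) *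
        ((if h ∣ d then (d : ℝ)⁻¹ else 0) * if h ∣ e then (e : ℝ)⁻¹ else 0) :=
        sum_le_sum fun d hd ↦ sum_le_sum fun e he ↦ hgcd d hd e he
    _ = ∑ h ∈ Icc 1 N, (h : ℝ) * (∑ d ∈ Icc 1 N with h ∣ d, ((d : ℝ))⁻¹) ^ 2 := by
        rw [sum_congr rfl fun d _ ↦ sum_comm, sum_comm]
        refine sum_congr rfl fun h _ ↦ ?_
        rw [sum_filter, sq, sum_mul_sum, mul_sum]
        simp only [mul_sum]
    _ ≤ ∑ h ∈ Icc 1 N, (h : ℝ) * ((h : ℝ)⁻¹ * H) ^ 2 := by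
        refine sum_le_sum fun h hh ↦ ?_
        have := sum_inv_filter_dvd_le N (mem_Icc.1 hh).1
        gcongr
    _ = ∑ h ∈ Icc 1 N, (h : ℝ)⁻¹ * H ^ 2 := by
        refine sum_congr rfl fun h hh ↦ ?_
        have : (h : ℝ) ≠ 0 := by
          have := (mem_Icc.1 hh).1
          positivity
        field_simp
    _ = H ^ 3 := by
        rw [← sum_mul, ← hH]
        ring

/-- The coefficient of `countDev δ d` in the sum over all denominators. -/
noncomputable def moebiusWeight (𝒬 : Finset ℕ) (d : ℕ) : ℝ :=
  ∑ q ∈ 𝒬 with d ∣ q, (μ (q / d) : ℝ)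

lemma abs_moebiusWeight_le {𝒬 : Finset ℕ} {N : ℕ} (h𝒬 : ∀ q ∈ 𝒬, 0 < q ∧ q ≤ N) (d : ℕ) :
    |moebiusWeight 𝒬 d| ≤ N * (d : ℝ)⁻¹ := by
  have h1 : |moebiusWeight 𝒬 d| ≤ ∑ q ∈ 𝒬 with d ∣ q, (1 : ℝ) := by
    refine (abs_sum_le_sum_abs _ _).trans (sum_le_sum fun q _ ↦ ?_)
    exact_mod_cast abs_moebius_le_one
  have h2 : #{q ∈ 𝒬 | d ∣ q} ≤ N / d := by
    rw [← Nat.Ioc_filter_dvd_card_eq_div]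
    exact card_le_card (filter_subset_filter _ fun q hq ↦ mem_Ioc.2 (h𝒬 q hq))
  rw [sum_const, nsmul_eq_mul, mul_one] at h1
  refine h1.trans ((Nat.cast_le.2 h2).trans ?_)
  rw [← div_eq_mul_inv]
  exact Nat.cast_div_le

lemma sum_sum_moebius_mul_eq {𝒬 : Finset ℕ} {N : ℕ} (h𝒬 : ∀ q ∈ 𝒬, 0 < q ∧ q ≤ N) (f : ℕ → ℝ) :
    ∑ q ∈ 𝒬, ∑ y ∈ q.divisorsAntidiagonal, (μ y.1 : ℝ) * f y.2 =
      ∑ d ∈ Icc 1 N, moebiusWeight 𝒬 d * f d := by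
  have h1 : ∀ q ∈ 𝒬, ∑ y ∈ q.divisorsAntidiagonal, (μ y.1 : ℝ) * f y.2 =
      ∑ d ∈ Icc 1 N, if d ∣ q then (μ (q / d) : ℝ) * f d else 0 := fun q hq ↦ by
    obtain ⟨hq0, hqN⟩ := h𝒬 q hq
    rw [← Nat.map_div_left_divisors, sum_map, ← sum_filter]
    refine sum_congr ?_ fun d _ ↦ rfl
    ext d
    simp only [Nat.mem_divisors, mem_filter, mem_Icc]
    constructor
    · rintro ⟨h, _⟩
      exact ⟨⟨Nat.pos_of_dvd_of_pos h hq0, (Nat.le_of_dvd hq0 h).trans hqN⟩, h⟩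
    · rintro ⟨_, h⟩
      exact ⟨h, hq0.ne'⟩
  rw [sum_congr rfl h1, sum_comm]
  refine sum_congr rfl fun d _ ↦ ?_
  rw [← sum_filter, moebiusWeight, sum_mul]

lemma jutilaApprox_eq {𝒬 : Finset ℕ} (hne : 𝒬.Nonempty) {N : ℕ}
    (h𝒬 : ∀ q ∈ 𝒬, 0 < q ∧ q ≤ N) {δ : ℝ} (hδ : 0 < δ) (x : ℝ) :
    jutilaApprox 𝒬 δ x = 1 + (2 * δ * ∑ q ∈ 𝒬, (Nat.totient q : ℝ))⁻¹ *
      ∑ d ∈ Icc 1 N, moebiusWeight 𝒬 d * countDev δ d x := by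
  have hL : 0 < ∑ q ∈ 𝒬, (Nat.totient q : ℝ) :=
    sum_pos (fun q hq ↦ Nat.cast_pos.2 (Nat.totient_pos.2 (h𝒬 q hq).1)) hne
  rw [jutilaApprox, sum_congr rfl fun q hq ↦ tsum_reduced_fractions hδ.le (h𝒬 q hq).1 x,
    sum_add_distrib, sum_sum_moebius_mul_eq h𝒬 fun d ↦ countDev δ d x, ← mul_sum, mul_add,
    inv_mul_cancel₀ (by positivity)]

lemma integral_sq_sum_moebiusWeight_le {𝒬 : Finset ℕ} {N : ℕ}
    (h𝒬 : ∀ q ∈ 𝒬, 0 < q ∧ q ≤ N) {δ : ℝ} (hδ : 0 ≤ δ) :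
    ∫ x in (0 : ℝ)..1, (∑ d ∈ Icc 1 N, moebiusWeight 𝒬 d * countDev δ d x) ^ 2 ≤
      4 * δ * N ^ 2 * (∑ d ∈ Icc 1 N, ((d : ℝ))⁻¹) ^ 3 := by
  have hmul_int (d e : ℕ) : IntervalIntegrable (fun x ↦ countDev δ d x * countDev δ e x)
      volume 0 1 := by
    refine intervalIntegrable_of_abs_le (M := 1)
      ((measurable_countDev δ d).mul (measurable_countDev δ e)) (fun x ↦ ?_) 0 1
    rw [Pi.mul_apply, abs_mul]
    exact mul_le_one₀ (abs_countDev_le _ _ _) (abs_nonneg _) (abs_countDev_le _ _ _)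
  have hexpand (x : ℝ) : (∑ d ∈ Icc 1 N, moebiusWeight 𝒬 d * countDev δ d x) ^ 2 =
      ∑ d ∈ Icc 1 N, ∑ e ∈ Icc 1 N, moebiusWeight 𝒬 d * moebiusWeight 𝒬 e *
        (countDev δ d x * countDev δ e x) := by
    rw [sq, sum_mul_sum]
    exact sum_congr rfl fun d _ ↦ sum_congr rfl fun e _ ↦ by ring
  simp only [hexpand]
  have hsum_int (d : ℕ) : IntervalIntegrable (fun x ↦ ∑ e ∈ Icc 1 N,
      moebiusWeight 𝒬 d * moebiusWeight 𝒬 e * (countDev δ d x * countDev δ e x)) volume 0 1 := by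
    simpa only [Finset.sum_fn] using IntervalIntegrable.sum (Icc 1 N)
      (f := fun e x ↦ moebiusWeight 𝒬 d * moebiusWeight 𝒬 e * (countDev δ d x * countDev δ e x))
      fun e _ ↦ (hmul_int d e).const_mul _
  rw [intervalIntegral.integral_finsetSum fun d _ ↦ hsum_int d]
  calc ∑ d ∈ Icc 1 N, ∫ x in (0 : ℝ)..1, ∑ e ∈ Icc 1 N, moebiusWeight 𝒬 d * moebiusWeight 𝒬 e *
        (countDev δ d x * countDev δ e x)
      = ∑ d ∈ Icc 1 N, ∑ e ∈ Icc 1 N, moebiusWeight 𝒬 d * moebiusWeight 𝒬 e *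
        ∫ x in (0 : ℝ)..1, countDev δ d x * countDev δ e x := by
        refine sum_congr rfl fun d _ ↦ ?_
        rw [intervalIntegral.integral_finsetSum fun e _ ↦ (hmul_int d e).const_mul _]
        exact sum_congr rfl fun e _ ↦ intervalIntegral.integral_const_mul _ _
    _ ≤ ∑ d ∈ Icc 1 N, ∑ e ∈ Icc 1 N, N * (d : ℝ)⁻¹ * (N * (e : ℝ)⁻¹) *
        (4 * δ * Nat.gcd d e) := by
        refine sum_le_sum fun d hd ↦ sum_le_sum fun e _ ↦ (le_abs_self _).trans ?_
        rw [abs_mul, abs_mul]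
        have h1 := abs_moebiusWeight_le h𝒬 d
        have h2 := abs_moebiusWeight_le h𝒬 e
        have h3 := abs_integral_countDev_mul_le hδ (e := e) (mem_Icc.1 hd).1
        gcongr
    _ = 4 * δ * N ^ 2 * ∑ d ∈ Icc 1 N, ∑ e ∈ Icc 1 N,
        (d : ℝ)⁻¹ * (e : ℝ)⁻¹ * Nat.gcd d e := by
        simp only [mul_sum]
        exact sum_congr rfl fun d _ ↦ sum_congr rfl fun e _ ↦ by ring
    _ ≤ _ := by
        gcongr
        exact sum_gcd_div_mul_le N

lemma one_add_log_pow_three_le {ε : ℝ} (hε : 0 < ε) {Q : ℝ} (hQ : 1 ≤ Q) :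
    (1 + Real.log Q) ^ 3 ≤ (1 + 3 / ε) ^ 3 * Q ^ ε := by
  have hQ0 : 0 ≤ Q := zero_le_one.trans hQ
  have h1 : Real.log Q ≤ Q ^ (ε / 3) / (ε / 3) := Real.log_le_rpow_div hQ0 (by positivity)
  have h2 : 1 ≤ Q ^ (ε / 3) := Real.one_le_rpow hQ (by positivity)
  have h3 : 1 + Real.log Q ≤ (1 + 3 / ε) * Q ^ (ε / 3) := by
    have : Q ^ (ε / 3) / (ε / 3) = 3 / ε * Q ^ (ε / 3) := by field_simp
    linarith
  have h4 : (Q ^ (ε / 3)) ^ 3 = Q ^ ε := by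
    rw [← Real.rpow_natCast, ← Real.rpow_mul hQ0]
    congr 1
    push_cast
    ring
  have := Real.log_nonneg hQ
  rw [← h4, ← mul_pow]
  gcongr

/-- Jutila's L² approximation lemma: for `𝒬 ⊆ [1,Q]` and `Q⁻² ≤ δ ≤ Q⁻¹`,
`∫₀¹ |1 - Ĩ_{𝒬,δ}(x)|² dx ≪_ε Q^{2+ε} / (δ L²)`. -/
theorem jutila_L2_bound :
    ∀ ε : ℝ, 0 < ε → ∃ C : ℝ, 0 < C ∧
      ∀ Q : ℝ, 1 ≤ Q →
      ∀ 𝒬 : Finset ℕ, 𝒬.Nonempty → (∀ q ∈ 𝒬, 0 < q ∧ (q : ℝ) ≤ Q) →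
      ∀ δ : ℝ, Q ^ (-2 : ℝ) ≤ δ → δ ≤ Q ^ (-1 : ℝ) →
        (∫ x in (0:ℝ)..1, |1 - jutilaApprox 𝒬 δ x| ^ 2) ≤
          C * Q ^ (2 + ε) / (δ * (∑ q ∈ 𝒬, (Nat.totient q : ℝ)) ^ 2) := by
  intro ε hε
  refine ⟨(1 + 3 / ε) ^ 3, by positivity, fun Q hQ 𝒬 hne h𝒬 δ hδ _ ↦ ?_⟩
  have hQ0 : 0 < Q := zero_lt_one.trans_le hQ
  have hδ0 : 0 < δ := (Real.rpow_pos_of_pos hQ0 _).trans_le hδ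
  set N := ⌊Q⌋₊
  have hN : 0 < N := Nat.floor_pos.2 hQ
  have hNQ : (N : ℝ) ≤ Q := Nat.floor_le hQ0.le
  have h𝒬N : ∀ q ∈ 𝒬, 0 < q ∧ q ≤ N := fun q hq ↦ ⟨(h𝒬 q hq).1, Nat.le_floor (h𝒬 q hq).2⟩
  set L := ∑ q ∈ 𝒬, (Nat.totient q : ℝ) with hLdef
  have hL : 0 < L :=
    sum_pos (fun q hq ↦ Nat.cast_pos.2 (Nat.totient_pos.2 (h𝒬 q hq).1)) hne
  have hsq (x : ℝ) : |1 - jutilaApprox 𝒬 δ x| ^ 2 = ((2 * δ * L)⁻¹) ^ 2 *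
      (∑ d ∈ Icc 1 N, moebiusWeight 𝒬 d * countDev δ d x) ^ 2 := by
    rw [sq_abs, jutilaApprox_eq hne h𝒬N hδ0]
    ring
  have hH : ∑ d ∈ Icc 1 N, ((d : ℝ))⁻¹ ≤ 1 + Real.log Q := by
    refine (sum_inv_Icc_le N).trans ?_
    gcongr
  have hQε : Q ^ (2 + ε) = Q ^ 2 * Q ^ ε := by
    rw [Real.rpow_add hQ0, Real.rpow_two]
  simp only [hsq]
  rw [intervalIntegral.integral_const_mul]
  calc ((2 * δ * L)⁻¹) ^ 2 *
        ∫ x in (0 : ℝ)..1, (∑ d ∈ Icc 1 N, moebiusWeight 𝒬 d * countDev δ d x) ^ 2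
      ≤ ((2 * δ * L)⁻¹) ^ 2 * (4 * δ * N ^ 2 * (∑ d ∈ Icc 1 N, ((d : ℝ))⁻¹) ^ 3) := by
        gcongr
        exact integral_sq_sum_moebiusWeight_le h𝒬N hδ0.le
    _ ≤ ((2 * δ * L)⁻¹) ^ 2 * (4 * δ * Q ^ 2 * ((1 + 3 / ε) ^ 3 * Q ^ ε)) := by
        have := one_add_log_pow_three_le hε hQ
        gcongr
        refine le_trans ?_ this
        gcongr
    _ = (1 + 3 / ε) ^ 3 * Q ^ (2 + ε) / (δ * L ^ 2) := by
        rw [hQε]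
        generalize (1 + 3 / ε) ^ 3 = c
        field_simp
        ring
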